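/- For every T-tangle τ of S and every finite set X ⊆ V there is exactly one connected component C of G − X with (V∖C, X ∪ C) ∈ τ; the resulting function f_τ : X ↦ C is a direction in G, and the map τ ↦ f_τ is a bijection from the set of T-tangles of S onto the set of directions in G. -/

import Mathlib

open Set

variable {V : Type*}

/-- `{A,B}` is a separation of `G`: `A ∪ B = V` and no edge between `A∖B` and `B∖A`. -/
def IsSep (G : SimpleGraph V) (A B : Set V) : Prop :=
  A ∪ B = Set.univ ∧ ∀ a ∈ A \ B, ∀ b ∈ B \ A, ¬ G.Adj a b

/-- A separation of finite order. -/
def IsFinSep (G : SimpleGraph V) (A B : Set V) : Prop :=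
  IsSep G A B ∧ (A ∩ B).Finite

/-- The set `S⃗` of oriented finite-order separations of `G`, as ordered pairs. -/
def Svec (G : SimpleGraph V) : Set (Set V × Set V) :=
  {p | IsFinSep G p.1 p.2}

/-- `(A,B) ≤ (C,D)` iff `A ⊆ C` and `D ⊆ B`. -/
def sepLE (p q : Set V × Set V) : Prop :=
  p.1 ⊆ q.1 ∧ q.2 ⊆ p.2

/-- An orientation of the set `S` of finite-order separations: a subset of `S⃗` containing
exactly one of `(A,B)`, `(B,A)` for every finite-order separation `{A,B}`. -/
def IsOrientation (G : SimpleGraph V) (O : Set (Set V × Set V)) : Prop :=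
  O ⊆ Svec G ∧ ∀ A B : Set V, IsFinSep G A B → ((A, B) ∈ O ↔ (B, A) ∉ O)

/-- Consistency: no two distinct members `(B,A)`, `(C,D)` with `(A,B) < (C,D)`. -/
def Consistent (O : Set (Set V × Set V)) : Prop :=
  ∀ A B C D : Set V, (B, A) ∈ O → (C, D) ∈ O → (B, A) ≠ (C, D) →
    ¬ (sepLE (A, B) (C, D) ∧ (A, B) ≠ (C, D))

/-- A star in `S⃗`: every two distinct elements point towards each other. -/
def IsStar (G : SimpleGraph V) (σ : Set (Set V × Set V)) : Prop :=
  σ ⊆ Svec G ∧ ∀ p ∈ σ, ∀ q ∈ σ, p ≠ q → sepLE p (q.2, q.1)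

/-- Membership in `T_n`: a star of at most `n` elements whose target sides have finite
intersection. -/
def InTn (G : SimpleGraph V) (n : ℕ) (σ : Set (Set V × Set V)) : Prop :=
  IsStar G σ ∧ σ.Finite ∧ σ.ncard ≤ n ∧ (⋂ p ∈ σ, p.2).Finite

/-- Membership in `T`: an arbitrary star whose target sides have finite intersection. -/
def InT (G : SimpleGraph V) (σ : Set (Set V × Set V)) : Prop :=
  IsStar G σ ∧ (⋂ p ∈ σ, p.2).Finite

/-- An `ℵ₀`-tangle of `G`: a consistent orientation of `S` with no subset in `T₃`. -/
def IsTangle (G : SimpleGraph V) (τ : Set (Set V × Set V)) : Prop :=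
  IsOrientation G τ ∧ Consistent τ ∧ ∀ σ ⊆ τ, ¬ InTn G 3 σ

/-- A `T`-tangle of `S`: a consistent orientation of `S` with no subset in `T`. -/
def IsTTangle (G : SimpleGraph V) (τ : Set (Set V × Set V)) : Prop :=
  IsOrientation G τ ∧ Consistent τ ∧ ∀ σ ⊆ τ, ¬ InT G σ

/-- The set `𝒞_X` of (vertex sets of) connected components of `G − X`. -/
def Comps (G : SimpleGraph V) (X : Set V) : Set (Set V) :=
  {C | ∃ c : (G.induce Xᶜ).ConnectedComponent, C = Subtype.val '' c.supp}

/-- A collection of subsets of `α` is an ultrafilter on `α`. -/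
def IsUltra {α : Type*} (F : Set (Set α)) : Prop :=
  ∅ ∉ F ∧ (∀ s ∈ F, ∀ t ∈ F, s ∩ t ∈ F) ∧ (∀ s ∈ F, ∀ t : Set α, s ⊆ t → t ∈ F) ∧
    ∀ s : Set α, s ∈ F ∨ sᶜ ∈ F

/-- A principal ultrafilter, generated by a single point. -/
def IsPrincipalUF {α : Type*} (F : Set (Set α)) : Prop :=
  ∃ a : α, F = {s | a ∈ s}

/-- `U(τ,X)`: the collection of all sets `𝒮` of components of `G − X` with
`(⋃(𝒞_X∖𝒮) ∪ X, ⋃𝒮 ∪ X) ∈ τ`. -/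
def tangleUF (G : SimpleGraph V) (τ : Set (Set V × Set V)) (X : Set V) :
    Set (Set ↥(Comps G X)) :=
  {𝒮 | ((⋃ C ∈ 𝒮ᶜ, (C : Set V)) ∪ X, (⋃ C ∈ 𝒮, (C : Set V)) ∪ X) ∈ τ}

/-- `f_{X',X}`: the pushforward of an ultrafilter on `𝒞_{X'}` along the map sending each
component of `G − X'` to the component of `G − X` containing it. -/
def pushUF (G : SimpleGraph V) (X X' : Set V) (F : Set (Set ↥(Comps G X'))) :
    Set (Set ↥(Comps G X)) :=
  {𝒮 | {C' : ↥(Comps G X') | ∃ C ∈ 𝒮, (C' : Set V) ⊆ (C : Set V)} ∈ F}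

/-- A direction in `G`: a choice of a component of `G − X` for every finite `X ⊆ V`,
compatible under inclusion. -/
def IsDirection (G : SimpleGraph V) (f : Set V → Set V) : Prop :=
  (∀ X : Set V, X.Finite → f X ∈ Comps G X) ∧
    ∀ X X' : Set V, X.Finite → X'.Finite → X ⊆ X' → f X' ⊆ f X

section Components

variable {G : SimpleGraph V} {X X' C D : Set V}

theorem Comps.nonempty (hC : C ∈ Comps G X) : C.Nonempty := by
  obtain ⟨c, rfl⟩ := hC
  exact c.nonempty_supp.image _

theorem Comps.notMem (hC : C ∈ Comps G X) {v : V} (hv : v ∈ C) : v ∉ X := by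
  obtain ⟨c, rfl⟩ := hC
  obtain ⟨w, -, rfl⟩ := hv
  exact w.2

/-- A component of `G − X` is closed under taking neighbours outside `X`. -/
theorem Comps.mem_of_adj (hC : C ∈ Comps G X) {a b : V} (ha : a ∈ C) (hb : b ∉ X)
    (hab : G.Adj a b) : b ∈ C := by
  obtain ⟨c, rfl⟩ := hC
  obtain ⟨w, hw, rfl⟩ := ha
  have hadj : (G.induce Xᶜ).Adj w ⟨b, hb⟩ := hab
  exact ⟨⟨b, hb⟩, c.mem_supp_of_adj_mem_supp hw hadj, rfl⟩

/-- A component is contained in every set that it meets and that is closed under adjacency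
within the component. -/
theorem Comps.subset_of_adj_closed (hC : C ∈ Comps G X) {P : Set V} {v : V} (hv : v ∈ C)
    (hvP : v ∈ P) (hP : ∀ a ∈ C, ∀ b ∈ C, G.Adj a b → a ∈ P → b ∈ P) : C ⊆ P := by
  obtain ⟨c, rfl⟩ := hC
  obtain ⟨v, hv, rfl⟩ := hv
  rintro _ ⟨w, hw, rfl⟩
  obtain ⟨walk⟩ := SimpleGraph.ConnectedComponent.exact (hv.trans hw.symm)
  induction walk with
  | nil => exact hvP
  | cons hadj _ ih =>
    have hu := c.mem_supp_of_adj_mem_supp hv hadj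
    exact ih hu (hP _ ⟨_, hv, rfl⟩ _ ⟨_, hu, rfl⟩ hadj hvP) hw

theorem Comps.exists_mem (G : SimpleGraph V) {v : V} (hv : v ∉ X) : ∃ C ∈ Comps G X, v ∈ C :=
  ⟨_, ⟨(G.induce Xᶜ).connectedComponentMk ⟨v, hv⟩, rfl⟩, ⟨v, hv⟩, rfl, rfl⟩

theorem Comps.subset_of_mem (hXX' : X ⊆ X') (hC : C ∈ Comps G X') (hD : D ∈ Comps G X) {v : V}
    (hvC : v ∈ C) (hvD : v ∈ D) : C ⊆ D :=
  Comps.subset_of_adj_closed hC hvC hvD fun _ _ _ hb hab ha =>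
    Comps.mem_of_adj hD ha (fun hbX => Comps.notMem hC hb (hXX' hbX)) hab

theorem Comps.eq_of_mem (hC : C ∈ Comps G X) (hD : D ∈ Comps G X) {v : V}
    (hvC : v ∈ C) (hvD : v ∈ D) : C = D :=
  (Comps.subset_of_mem subset_rfl hC hD hvC hvD).antisymm
    (Comps.subset_of_mem subset_rfl hD hC hvD hvC)

theorem IsFinSep.symm {A B : Set V} (h : IsFinSep G A B) : IsFinSep G B A :=
  ⟨⟨by rw [union_comm]; exact h.1.1, fun a ha b hb hab => h.1.2 b hb a ha hab.symm⟩,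
    by rw [inter_comm]; exact h.2⟩

theorem IsFinSep.mem_or_mem {A B : Set V} (h : IsFinSep G A B) (v : V) : v ∈ A ∨ v ∈ B :=
  (mem_union v A B).mp (h.1.1 ▸ mem_univ v)

theorem IsFinSep.union_left {A B Y : Set V} (h : IsFinSep G A B) (hY : Y.Finite) :
    IsFinSep G (A ∪ Y) B := by
  refine ⟨⟨?_, fun a ha b hb => h.1.2 a ?_ b ?_⟩, (h.2.union hY).subset ?_⟩
  · ext v
    have := h.mem_or_mem v
    grind
  · have := h.mem_or_mem a
    grind
  · grind
  · grind

theorem Comps.compl_inter (hC : C ∈ Comps G X) : Cᶜ ∩ (X ∪ C) = X := by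
  ext v
  have := fun h => Comps.notMem hC (v := v) h
  grind

theorem Comps.isFinSep (hX : X.Finite) (hC : C ∈ Comps G X) : IsFinSep G Cᶜ (X ∪ C) := by
  refine ⟨⟨by ext v; by_cases v ∈ C <;> simp_all, fun a ha b hb hab => ?_⟩,
    by rwa [Comps.compl_inter hC]⟩
  have hbC : b ∈ C := not_not.mp hb.2
  exact ha.1 (Comps.mem_of_adj hC hbC (fun haX => ha.2 (Or.inl haX)) hab.symm)

/-- A component of `G − (A ∩ B)` lies on one side of the separation `{A,B}`. -/
theorem IsFinSep.comps_subset_or {A B : Set V} (h : IsFinSep G A B) (hC : C ∈ Comps G (A ∩ B)) :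
    C ⊆ A ∨ C ⊆ B := by
  by_contra! hne
  obtain ⟨hA, hB⟩ := hne
  obtain ⟨v, hvC, hvA⟩ := not_subset.mp hA
  have hvB := (h.mem_or_mem v).resolve_left hvA
  refine hB (Comps.subset_of_adj_closed hC hvC hvB fun a ha b hb hab haB => ?_)
  by_contra hbB
  have hbA := (h.mem_or_mem b).resolve_right hbB
  exact h.1.2 b ⟨hbA, hbB⟩ a ⟨haB, fun haA => Comps.notMem hC ha ⟨haA, haB⟩⟩ hab.symm

end Components

namespace IsTTangle

variable {G : SimpleGraph V} {τ : Set (Set V × Set V)}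

theorem isFinSep (hτ : IsTTangle G τ) {A B : Set V} (h : (A, B) ∈ τ) : IsFinSep G A B :=
  hτ.1.1 h

theorem swap_notMem (hτ : IsTTangle G τ) {A B : Set V} (h : (A, B) ∈ τ) : (B, A) ∉ τ :=
  (hτ.1.2 A B (hτ.isFinSep h)).mp h

theorem swap_mem (hτ : IsTTangle G τ) {A B : Set V} (hs : IsFinSep G A B) (h : (A, B) ∉ τ) :
    (B, A) ∈ τ :=
  (hτ.1.2 B A hs.symm).mpr h

theorem infinite_right (hτ : IsTTangle G τ) {A B : Set V} (h : (A, B) ∈ τ) : B.Infinite := by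
  intro hB
  refine hτ.2.2 {(A, B)} (by simpa using h) ⟨⟨by simpa using hτ.1.1 h, ?_⟩, by simpa using hB⟩
  rintro p rfl q rfl hpq
  exact absurd rfl hpq

/-- A `T`-tangle is closed downwards. -/
theorem mem_of_le (hτ : IsTTangle G τ) {A B C D : Set V} (hs : IsFinSep G A B)
    (h : (C, D) ∈ τ) (hAC : A ⊆ C) (hDB : D ⊆ B) : (A, B) ∈ τ := by
  by_contra hAB
  have hBA := hτ.swap_mem hs hAB
  refine hτ.2.1 A B C D hBA h ?_ ⟨⟨hAC, hDB⟩, fun heq => hAB (heq ▸ h)⟩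
  intro heq
  obtain ⟨rfl, rfl⟩ := Prod.mk.inj heq
  exact hτ.infinite_right h ((hτ.isFinSep h).2.subset fun v hv => ⟨hAC hv, hv⟩)

/-- A `T`-tangle is closed under adding finitely many vertices to both sides of a separation. -/
theorem union_mem (hτ : IsTTangle G τ) {A B Y : Set V} (h : (A, B) ∈ τ) (hY : Y.Finite) :
    (A ∪ Y, B ∪ Y) ∈ τ := by
  have hs := hτ.isFinSep h
  have hB : (A, B ∪ Y) ∈ τ :=
    hτ.mem_of_le (hs.symm.union_left hY).symm h subset_rfl subset_union_left
  have hs' : IsFinSep G (A ∪ Y) (B ∪ Y) := (hτ.isFinSep hB).union_left hY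
  by_contra hne
  have hrev := hτ.swap_mem hs' hne
  refine hτ.2.2 {(A, B ∪ Y), (B ∪ Y, A ∪ Y)} ?_ ⟨⟨?_, ?_⟩, ?_⟩
  · rintro p (rfl | rfl)
    exacts [hB, hrev]
  · rintro p (rfl | rfl)
    exacts [hτ.1.1 hB, hτ.1.1 hrev]
  · rintro p (rfl | rfl) q (rfl | rfl) hpq
    · exact absurd rfl hpq
    · exact ⟨subset_union_left, subset_rfl⟩
    · exact ⟨subset_rfl, subset_union_left⟩
    · exact absurd rfl hpq
  · rw [biInter_pair, inter_comm]
    exact hs'.2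

theorem existsUnique_comp (hτ : IsTTangle G τ) {X : Set V} (hX : X.Finite) :
    ∃! C : Set V, C ∈ Comps G X ∧ (Cᶜ, X ∪ C) ∈ τ := by
  have hdisj : ∀ C ∈ Comps G X, ∀ D ∈ Comps G X, C ≠ D → X ∪ C ⊆ Dᶜ := by
    rintro C hC D hD hne v (hv | hv) hvD
    · exact Comps.notMem hD hvD hv
    · exact hne (Comps.eq_of_mem hC hD hv hvD)
  have hex : ∃ C : Set V, C ∈ Comps G X ∧ (Cᶜ, X ∪ C) ∈ τ := by
    by_contra! hno
    have hmem : ∀ C ∈ Comps G X, (X ∪ C, Cᶜ) ∈ τ := fun C hC =>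
      hτ.swap_mem (Comps.isFinSep hX hC) (hno C hC)
    refine hτ.2.2 ((fun C => (X ∪ C, Cᶜ)) '' Comps G X) ?_ ⟨⟨?_, ?_⟩, hX.subset ?_⟩
    · rintro _ ⟨C, hC, rfl⟩
      exact hmem C hC
    · rintro _ ⟨C, hC, rfl⟩
      exact hτ.1.1 (hmem C hC)
    · rintro _ ⟨C, hC, rfl⟩ _ ⟨D, hD, rfl⟩ hne
      have hCD : C ≠ D := fun h => hne (by rw [h])
      exact ⟨hdisj C hC D hD hCD, hdisj D hD C hC hCD.symm⟩
    · intro v hv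
      by_contra hvX
      obtain ⟨C, hC, hvC⟩ := Comps.exists_mem G hvX
      exact mem_iInter₂.mp hv _ ⟨C, hC, rfl⟩ hvC
  obtain ⟨C, hC, hCτ⟩ := hex
  refine ⟨C, ⟨hC, hCτ⟩, ?_⟩
  rintro D ⟨hD, hDτ⟩
  by_contra hne
  exact hτ.swap_notMem hDτ (hτ.mem_of_le (Comps.isFinSep hX hD).symm hCτ
    (hdisj D hD C hC hne) (hdisj C hC D hD (Ne.symm hne)))

/-- The components selected by a `T`-tangle are compatible under inclusion. -/
theorem comp_subset (hτ : IsTTangle G τ) {X X' C C' : Set V} (hX : X.Finite) (hX' : X'.Finite)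
    (hXX' : X ⊆ X') (hC : C ∈ Comps G X) (hCτ : (Cᶜ, X ∪ C) ∈ τ) (hC' : C' ∈ Comps G X')
    (hCτ' : (C'ᶜ, X' ∪ C') ∈ τ) : C' ⊆ C := by
  obtain ⟨v, hv⟩ := Comps.nonempty hC'
  obtain ⟨D, hD, hvD⟩ := Comps.exists_mem G fun h => Comps.notMem hC' hv (hXX' h)
  have hC'D := Comps.subset_of_mem hXX' hC' hD hv hvD
  by_cases hDτ : (Dᶜ, X ∪ D) ∈ τ
  · rwa [(hτ.existsUnique_comp hX).unique ⟨hC, hCτ⟩ ⟨hD, hDτ⟩]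
  · have hrev := hτ.union_mem (hτ.swap_mem (Comps.isFinSep hX hD) hDτ) hX'
    refine absurd (hτ.mem_of_le (Comps.isFinSep hX' hC').symm hrev ?_ ?_) (hτ.swap_notMem hCτ')
    · rintro w (hw | hw)
      exacts [Or.inr hw, Or.inl (Or.inr (hC'D hw))]
    · rintro w (hw | hw) hwC'
      exacts [hw (hC'D hwC'), Comps.notMem hC' hwC' hw]

/-- A `T`-tangle is determined by the components it selects. -/
theorem mem_iff (hτ : IsTTangle G τ) {f : Set V → Set V} (hf : IsDirection G f)
    (hfτ : ∀ X : Set V, X.Finite → ((f X)ᶜ, X ∪ f X) ∈ τ) {A B : Set V} :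
    (A, B) ∈ τ ↔ IsFinSep G A B ∧ f (A ∩ B) ⊆ B := by
  have key : ∀ {A B : Set V}, (A, B) ∈ τ → ¬ f (A ∩ B) ⊆ A := by
    intro A B h hfA
    have hs := hτ.isFinSep h
    have hC := hf.1 _ hs.2
    refine hτ.swap_notMem (hfτ _ hs.2) (hτ.mem_of_le (Comps.isFinSep hs.2 hC).symm h ?_ ?_)
    · exact union_subset inter_subset_left hfA
    · exact fun v hvB hvC => Comps.notMem hC hvC ⟨hfA hvC, hvB⟩
  constructor
  · intro h
    have hs := hτ.isFinSep h
    exact ⟨hs, (hs.comps_subset_or (hf.1 _ hs.2)).resolve_left (key h)⟩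
  · rintro ⟨hs, hfB⟩
    by_contra h
    exact key (hτ.swap_mem hs h) (by rwa [inter_comm])

end IsTTangle

namespace IsDirection

variable {G : SimpleGraph V} {f : Set V → Set V}

theorem inter_nonempty (hf : IsDirection G f) {X Y : Set V} (hX : X.Finite) (hY : Y.Finite) :
    ∃ v ∈ f X ∩ f Y, v ∉ X ∪ Y := by
  have hXY := hX.union hY
  obtain ⟨v, hv⟩ := Comps.nonempty (hf.1 _ hXY)
  exact ⟨v, ⟨hf.2 X _ hX hXY subset_union_left hv, hf.2 Y _ hY hXY subset_union_right hv⟩,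
    Comps.notMem (hf.1 _ hXY) hv⟩

/-- A direction orients every finite-order separation `{A,B}` towards the side containing
`f (A ∩ B)`, and this orientation is a `T`-tangle. -/
theorem isTTangle (hf : IsDirection G f) :
    IsTTangle G {p | IsFinSep G p.1 p.2 ∧ f (p.1 ∩ p.2) ⊆ p.2} := by
  refine ⟨⟨fun p hp => hp.1, fun A B hs => ⟨?_, ?_⟩⟩, ?_, ?_⟩
  · rintro ⟨-, hB⟩ ⟨-, hA⟩
    obtain ⟨v, hv⟩ := Comps.nonempty (hf.1 _ hs.2)
    rw [inter_comm] at hA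
    exact Comps.notMem (hf.1 _ hs.2) hv ⟨hA hv, hB hv⟩
  · intro h
    refine ⟨hs, (hs.comps_subset_or (hf.1 _ hs.2)).resolve_left fun hA => h ⟨hs.symm, ?_⟩⟩
    rwa [inter_comm] at hA
  · rintro A B C D ⟨hBA, hA⟩ ⟨hCD, hD⟩ - ⟨⟨hAC, -⟩, -⟩
    obtain ⟨v, ⟨hv, hv'⟩, hvn⟩ := hf.inter_nonempty hBA.2 hCD.2
    exact hvn (Or.inr ⟨hAC (hA hv), hD hv'⟩)
  · rintro σ hσ ⟨⟨-, hstar⟩, hfin⟩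
    have hC := hf.1 _ hfin
    have hout : ∀ v ∈ f (⋂ p ∈ σ, p.2), ∃ p ∈ σ, v ∉ p.2 := by
      intro v hv
      have := Comps.notMem hC hv
      simpa using this
    obtain ⟨v, hv⟩ := Comps.nonempty hC
    obtain ⟨p, hp, hvp⟩ := hout v hv
    have hps := (hσ hp).1
    have hsub : f (⋂ p ∈ σ, p.2) ⊆ p.2ᶜ := by
      refine Comps.subset_of_adj_closed hC hv hvp fun a _ b hb hab hap hbp => ?_
      have hbA : b ∈ p.1 := by
        by_contra hbA
        exact hps.1.2 a ⟨(hps.mem_or_mem a).resolve_right hap, hap⟩ b ⟨hbp, hbA⟩ hab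
      obtain ⟨q, hq, hbq⟩ := hout b hb
      have hpq : p ≠ q := fun h => hbq (h ▸ hbp)
      exact hbq ((hstar p hp q hq hpq).1 hbA)
    obtain ⟨w, ⟨hw, hw'⟩, -⟩ := hf.inter_nonempty hfin hps.2
    exact hsub hw ((hσ hp).2 hw')

end IsDirection

/-- Lemma 1.6: every `T`-tangle `τ` selects, for each finite `X`, a unique
component `C` of `G − X` with `(V∖C, X ∪ C) ∈ τ`; the resulting function is a direction,
and `τ ↦ f_τ` is a bijection from the `T`-tangles of `S` onto the directions in `G`. -/
theorem stmt4 [Infinite V] (G : SimpleGraph V) :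
    (∀ τ : Set (Set V × Set V), IsTTangle G τ → ∀ X : Set V, X.Finite →
        ∃! C : Set V, C ∈ Comps G X ∧ (Cᶜ, X ∪ C) ∈ τ) ∧
    (∀ τ : Set (Set V × Set V), IsTTangle G τ →
        ∃ f : Set V → Set V, IsDirection G f ∧
          ∀ X : Set V, X.Finite → ((f X)ᶜ, X ∪ f X) ∈ τ) ∧
    (∀ τ τ' : Set (Set V × Set V), ∀ f f' : Set V → Set V,
        IsTTangle G τ → IsTTangle G τ' →
        IsDirection G f → (∀ X : Set V, X.Finite → ((f X)ᶜ, X ∪ f X) ∈ τ) →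
        IsDirection G f' → (∀ X : Set V, X.Finite → ((f' X)ᶜ, X ∪ f' X) ∈ τ') →
        (∀ X : Set V, X.Finite → f X = f' X) → τ = τ') ∧
    (∀ f : Set V → Set V, IsDirection G f →
        ∃ τ : Set (Set V × Set V), IsTTangle G τ ∧
          ∀ X : Set V, X.Finite → ((f X)ᶜ, X ∪ f X) ∈ τ) := by
  refine ⟨fun τ hτ X hX => hτ.existsUnique_comp hX, fun τ hτ => ?_, ?_, fun f hf => ?_⟩
  · choose! f hf using fun (X : Set V) (hX : X.Finite) => (hτ.existsUnique_comp hX).exists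
    exact ⟨f, ⟨fun X hX => (hf X hX).1, fun X X' hX hX' hXX' =>
      hτ.comp_subset hX hX' hXX' (hf X hX).1 (hf X hX).2 (hf X' hX').1 (hf X' hX').2⟩,
      fun X hX => (hf X hX).2⟩
  · intro τ τ' f f' hτ hτ' hf hfτ hf' hfτ' heq
    ext ⟨A, B⟩
    rw [hτ.mem_iff hf hfτ, hτ'.mem_iff hf' hfτ']
    exact and_congr_right fun hs => by rw [heq _ hs.2]
  · refine ⟨_, hf.isTTangle, fun X hX => ⟨Comps.isFinSep hX (hf.1 X hX), ?_⟩⟩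
    rw [Comps.compl_inter (hf.1 X hX)]
    exact subset_union_right
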